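/- arXiv:1711.06705 — 2 statements merged into one kernel-verified Lean document; each statement's English description precedes it below -/
import Mathlib

section
/- Let E be a real inner product space and p₁ ≠ p₂ ∈ E. Let w ∈ E with ‖w‖ = 1 and c ∈ ℝ be such that ⟪w, p₁⟫ < c < ⟪w, p₂⟫ (so the hyperplane {x : ⟪w, x⟫ = c} separates p₁ from p₂). Then the margin min(c − ⟪w, p₁⟫, ⟪w, p₂⟫ − c) is at most ‖p₂ − p₁‖/2, and equality holds if and only if w = (p₂ − p₁)/‖p₂ − p₁‖ and c = ⟪w, (p₁ + p₂)/2⟫, i.e., if and only if the separating hyperplane is the perpendicular bisector of the segment from p₁ to p₂. -/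
open scoped RealInnerProductSpace

/-- Two-point SVM: among unit-normal hyperplanes `{x : ⟪w, x⟫ = c}` separating `p₁`
from `p₂`, the margin `min (c - ⟪w, p₁⟫) (⟪w, p₂⟫ - c)` is at most `‖p₂ - p₁‖ / 2`,
with equality iff the hyperplane is the perpendicular bisector of the segment from
`p₁` to `p₂`. -/
theorem stmt3 {E : Type*} [NormedAddCommGroup E] [InnerProductSpace ℝ E]
    (p₁ p₂ : E) (hne : p₁ ≠ p₂) (w : E) (hw : ‖w‖ = 1) (c : ℝ)
    (h₁ : ⟪w, p₁⟫ < c) (h₂ : c < ⟪w, p₂⟫) :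
    min (c - ⟪w, p₁⟫) (⟪w, p₂⟫ - c) ≤ ‖p₂ - p₁‖ / 2 ∧
    (min (c - ⟪w, p₁⟫) (⟪w, p₂⟫ - c) = ‖p₂ - p₁‖ / 2 ↔
      w = ‖p₂ - p₁‖⁻¹ • (p₂ - p₁) ∧ c = ⟪w, (2 : ℝ)⁻¹ • (p₁ + p₂)⟫) := by
  have hN : 0 < ‖p₂ - p₁‖ := norm_pos_iff.mpr (sub_ne_zero.mpr hne.symm)
  have hd : ⟪w, p₂ - p₁⟫ = ⟪w, p₂⟫ - ⟪w, p₁⟫ := inner_sub_right _ _ _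
  have hle : ⟪w, p₂ - p₁⟫ ≤ ‖p₂ - p₁‖ := by
    simpa [hw] using real_inner_le_norm w (p₂ - p₁)
  have hm : ⟪w, (2 : ℝ)⁻¹ • (p₁ + p₂)⟫ = (⟪w, p₁⟫ + ⟪w, p₂⟫) / 2 := by
    rw [real_inner_smul_right, inner_add_right]; ring
  have hiff : ⟪w, p₂ - p₁⟫ = ‖p₂ - p₁‖ ↔ w = ‖p₂ - p₁‖⁻¹ • (p₂ - p₁) := by
    have h := inner_eq_norm_mul_iff_real (x := w) (y := p₂ - p₁)
    rw [hw, one_mul, one_smul] at h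
    rw [h, eq_inv_smul_iff₀ hN.ne']
  rw [hm, ← hiff]
  have ha := min_le_left (c - ⟪w, p₁⟫) (⟪w, p₂⟫ - c)
  have hb := min_le_right (c - ⟪w, p₁⟫) (⟪w, p₂⟫ - c)
  refine ⟨by linarith, fun h => ⟨by linarith, by linarith⟩, ?_⟩
  rintro ⟨h, hc⟩
  rw [show c - ⟪w, p₁⟫ = ‖p₂ - p₁‖ / 2 by linarith,
    show ⟪w, p₂⟫ - c = ‖p₂ - p₁‖ / 2 by linarith, min_self]
end

section
/- Work in the Euclidean plane E = EuclideanSpace ℝ (Fin 2). Let p₁ ≠ p₂ ∈ E, let γ : ℝ → E be differentiable at t₀ with deriv γ t₀ ≠ 0, and suppose dist(γ(s), p₁) = dist(γ(s), p₂) for all s in a neighborhood of t₀. Set q = γ(t₀). Then the tangent line {q + r • deriv γ t₀ : r ∈ ℝ} coincides, as a subset of E, with the perpendicular bisector of p₁ and p₂, i.e., with the set {x ∈ E : dist(x, p₁) = dist(x, p₂)}. -/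
theorem equidist_iff (p₁ p₂ x : EuclideanSpace ℝ (Fin 2)) :
    dist x p₁ = dist x p₂ ↔
      2 * (p₂ 0 - p₁ 0) * x 0 + 2 * (p₂ 1 - p₁ 1) * x 1 =
        p₂ 0 ^ 2 + p₂ 1 ^ 2 - p₁ 0 ^ 2 - p₁ 1 ^ 2 := by
  rw [EuclideanSpace.dist_eq, EuclideanSpace.dist_eq,
    Real.sqrt_inj (by positivity) (by positivity)]
  simp only [Fin.sum_univ_two, Real.dist_eq, sq_abs]
  constructor <;> intro h <;> linarith

/-- In the Euclidean plane, if `γ` is differentiable at `t₀` with nonzero derivative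
and is equidistant from `p₁ ≠ p₂` near `t₀`, then the tangent line of `γ` at
`q = γ t₀` coincides with the perpendicular bisector of `p₁` and `p₂`, i.e., with
the set of points equidistant from `p₁` and `p₂`. -/
theorem stmt5 (p₁ p₂ : EuclideanSpace ℝ (Fin 2)) (hne : p₁ ≠ p₂)
    (γ : ℝ → EuclideanSpace ℝ (Fin 2)) (t₀ : ℝ)
    (hγ : DifferentiableAt ℝ γ t₀) (hv : deriv γ t₀ ≠ 0)
    (heq : ∀ᶠ s in nhds t₀, dist (γ s) p₁ = dist (γ s) p₂) :
    {x : EuclideanSpace ℝ (Fin 2) | ∃ r : ℝ, x = γ t₀ + r • deriv γ t₀} =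
      {x : EuclideanSpace ℝ (Fin 2) | dist x p₁ = dist x p₂} := by
  have hd : HasDerivAt γ (deriv γ t₀) t₀ := hγ.hasDerivAt
  generalize deriv γ t₀ = v at *
  have hc : ∀ i, HasDerivAt (fun s => γ s i) (v i) t₀ := fun i =>
    (EuclideanSpace.proj i : EuclideanSpace ℝ (Fin 2) →L[ℝ] ℝ).hasFDerivAt.comp_hasDerivAt t₀ hd
  have h0 := (equidist_iff p₁ p₂ (γ t₀)).1 heq.self_of_nhds
  have hperp : 2 * (p₂ 0 - p₁ 0) * v 0 + 2 * (p₂ 1 - p₁ 1) * v 1 = 0 := by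
    have h1 := ((hc 0).const_mul (2 * (p₂ 0 - p₁ 0))).add ((hc 1).const_mul (2 * (p₂ 1 - p₁ 1)))
    refine h1.unique ((hasDerivAt_const t₀
      (p₂ 0 ^ 2 + p₂ 1 ^ 2 - p₁ 0 ^ 2 - p₁ 1 ^ 2)).congr_of_eventuallyEq ?_)
    filter_upwards [heq] with s hs
    exact (equidist_iff p₁ p₂ (γ s)).1 hs
  have hv2 : v 0 ^ 2 + v 1 ^ 2 ≠ 0 := by
    intro h
    apply hv
    ext i
    fin_cases i
    · show v 0 = 0
      nlinarith [sq_nonneg (v 0), sq_nonneg (v 1)]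
    · show v 1 = 0
      nlinarith [sq_nonneg (v 0), sq_nonneg (v 1)]
  ext x
  simp only [Set.mem_ofPred_eq]
  rw [equidist_iff]
  constructor
  · rintro ⟨r, rfl⟩
    simp only [PiLp.add_apply, PiLp.smul_apply, smul_eq_mul]
    linear_combination h0 + r * hperp
  · intro hx
    have hcross : (x 0 - γ t₀ 0) * v 1 - (x 1 - γ t₀ 1) * v 0 = 0 := by
      by_contra hne0
      apply hne
      have ha : (p₂ 0 - p₁ 0) * ((x 0 - γ t₀ 0) * v 1 - (x 1 - γ t₀ 1) * v 0) = 0 := by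
        linear_combination (v 1 / 2) * (hx - h0) - ((x 1 - γ t₀ 1) / 2) * hperp
      have hb : (p₂ 1 - p₁ 1) * ((x 0 - γ t₀ 0) * v 1 - (x 1 - γ t₀ 1) * v 0) = 0 := by
        linear_combination (-v 0 / 2) * (hx - h0) + ((x 0 - γ t₀ 0) / 2) * hperp
      have ha' := (mul_eq_zero.1 ha).resolve_right hne0
      have hb' := (mul_eq_zero.1 hb).resolve_right hne0
      ext i
      fin_cases i
      · show p₁ 0 = p₂ 0
        linarith
      · show p₁ 1 = p₂ 1
        linarith
    refine ⟨((x 0 - γ t₀ 0) * v 0 + (x 1 - γ t₀ 1) * v 1) / (v 0 ^ 2 + v 1 ^ 2), ?_⟩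
    ext i
    fin_cases i
    · show x 0 = γ t₀ 0 + _ * v 0
      field_simp
      linear_combination v 1 * hcross
    · show x 1 = γ t₀ 1 + _ * v 1
      field_simp
      linear_combination -v 0 * hcross
end
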